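/- arXiv:2605.08602 — 5 statements merged into one kernel-verified Lean document; each statement's English description precedes it below -/
import Mathlib

section
/- Let g ∈ GT_λ, x = ς_λ(g) and 1 ≤ i ≤ n. (a) If max_{1 ≤ j ≤ n} σ_j^{(i)}(g) > 0 and v = max{ j ∈ {1,…,n} : σ_j^{(i)}(g) = max_{1 ≤ j' ≤ n} σ_{j'}^{(i)}(g) }, then σ^{(i)}(x) > 0, max M^{(i)}(x) = (v−1)n + i, and x − e_{(v−1)n+i} = ς_λ(g'), where g' is obtained from g by replacing y_v^{(i)} with y_v^{(i)} − 1. (b) If max_{1 ≤ j ≤ n} σ_j^{(i)}(g) > σ_0^{(i)}(g) and w = min{ j ∈ {1,…,n} : σ_j^{(i)}(g) = max_{1 ≤ j' ≤ n} σ_{j'}^{(i)}(g) }, then σ^{(i)}(x) > σ_0^{(i)}(x), min M^{(i)}(x) = (w−1)n + i, and x + e_{(w−1)n+i} = ς_λ(g''), where g'' is obtained from g by replacing y_w^{(i)} with y_w^{(i)} + 1. (Here e_k denotes the sequence that is 1 in position k and 0 elsewhere, and σ_0^{(i)}(g) is σ_j^{(i)}(g) with j = 0.) -/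
namespace PolyReal

/-- Cartan integers `⟨α_s^∨, α_t⟩` of type `A_n`. -/
def coef (s t : ℕ) : ℤ :=
  if s = t then 2 else if s + 1 = t ∨ t + 1 = s then -1 else 0

/-- Colour of position `k ≥ 1` for the periodic sequence `ι = (…, n, …, 2, 1)`:
position `k = (j-1)n + i` has colour `i`. -/
def col (n k : ℕ) : ℕ := (k - 1) % n + 1

/-- The component `x_j^{(i)} = x_{(j-1)n+i}`, with the conventions
`x_j^{(0)} := 0` and `x_j^{(n+1)} := 0` (indices out of `1 ≤ i ≤ n` give `0`). -/
def Xc (n : ℕ) (x : ℕ → ℤ) (i j : ℕ) : ℤ :=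
  if 1 ≤ i ∧ i ≤ n ∧ 1 ≤ j then x ((j - 1) * n + i) else 0

/-- Membership in `Σ_ι`: the chains `x_1^{(i)} ≥ x_2^{(i-1)} ≥ ⋯ ≥ x_i^{(1)} ≥ 0`
for `1 ≤ i ≤ n`, together with `x_j^{(i)} = 0` for `i + j > n + 1`
(and `x 0 = 0`, since sequences are indexed by positions `k ≥ 1`). -/
def InSigma (n : ℕ) (x : ℕ → ℤ) : Prop :=
  x 0 = 0 ∧
  (∀ i k, 1 ≤ i → i ≤ n → 1 ≤ k → k ≤ i →
    Xc n x (i - k) (k + 1) ≤ Xc n x (i + 1 - k) k) ∧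
  (∀ i j, 1 ≤ i → i ≤ n → 1 ≤ j → n + 1 < i + j → Xc n x i j = 0)

/-- Membership in `Σ_ι[λ]`. -/
def InSigmaL (n : ℕ) (lam : ℕ → ℤ) (x : ℕ → ℤ) : Prop :=
  InSigma n x ∧
  ∀ i j, 1 ≤ j → j ≤ i → i ≤ n →
    Xc n x (i - j + 1) j - Xc n x (i - j) j ≤ lam i - lam (i + 1)

/-- Hypotheses on `λ`: `λ_1 ≥ λ_2 ≥ ⋯ ≥ λ_n (≥ 0)` and `λ_{n+1} = 0`. -/
def IsShape (n : ℕ) (lam : ℕ → ℤ) : Prop :=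
  (∀ i, 1 ≤ i → i ≤ n → lam (i + 1) ≤ lam i) ∧ lam (n + 1) = 0

/-- `σ_k(x) = x_k + Σ_{l>k} ⟨α_{i_k}^∨, α_{i_l}⟩ x_l`.  For every sequence occurring
below the support is contained in positions `≤ n²`, so the sum may be truncated
at `n² + n`. -/
def sig (n : ℕ) (x : ℕ → ℤ) (k : ℕ) : ℤ :=
  x k + ∑ l ∈ Finset.Ioc k (n * n + n), coef (col n k) (col n l) * x l

/-- `σ^{(i)}(x) = max_{k : i_k = i} σ_k(x)`; for the sequences considered here this
maximum is attained among the positions `(j-1)n + i` with `1 ≤ j ≤ n+1`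
(`σ` vanishes at all later positions of colour `i`). -/
def sigmaI (n : ℕ) (x : ℕ → ℤ) (i : ℕ) : ℤ :=
  Finset.sup' (Finset.Icc 1 (n + 1)) (Finset.nonempty_Icc.mpr (by omega))
    (fun j => sig n x ((j - 1) * n + i))

/-- `M^{(i)}(x) = { k : i_k = i, σ_k(x) = σ^{(i)}(x) }`. -/
def Mset (n : ℕ) (x : ℕ → ℤ) (i : ℕ) : Set ℕ :=
  {k | 1 ≤ k ∧ col n k = i ∧ sig n x k = sigmaI n x i}

/-- `σ_0^{(i)}(x) = -(λ_i - λ_{i+1}) + Σ_{l ≥ 1} ⟨α_i^∨, α_{i_l}⟩ x_l`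
(again with the sum truncated beyond the support). -/
def sigma0 (n : ℕ) (lam : ℕ → ℤ) (x : ℕ → ℤ) (i : ℕ) : ℤ :=
  -(lam i - lam (i + 1)) + ∑ l ∈ Finset.Icc 1 (n * n + n), coef i (col n l) * x l

/-- The elementary sequence `e_k`. -/
def eVec (k : ℕ) : ℕ → ℤ := fun l => if l = k then 1 else 0

/-- `Λ_i^{(k)}(x) = x_k^{(i-1)} + λ_{k+i-1}`, set to `0` when `k > n+2-i`. -/
def Lam (n : ℕ) (lam : ℕ → ℤ) (x : ℕ → ℤ) (i k : ℕ) : ℤ :=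
  if 1 ≤ k ∧ k ≤ n + 2 - i then Xc n x (i - 1) k + lam (k + i - 1) else 0

/-- A z-array: a family of nonnegative integers indexed by
`1 ≤ m ≤ n`, `1 ≤ k ≤ n+1-m` (and `0` outside this index range). -/
def IsZArray (n : ℕ) (Z : ℕ → ℕ → ℤ) : Prop :=
  (∀ m k, 1 ≤ m → m ≤ n → 1 ≤ k → k ≤ n + 1 - m → 0 ≤ Z m k) ∧
  (∀ m k, ¬(1 ≤ m ∧ m ≤ n ∧ 1 ≤ k ∧ k ≤ n + 1 - m) → Z m k = 0)

/-- `ψ_∞(Z)`: the sequence with `x_j^{(i)} = Σ_{k=1}^{i} z(n+2-i-j, k)` for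
`i + j ≤ n+1` and `x_j^{(i)} = 0` for `i + j > n+1`.  (For a position `p ≥ 1`,
`i = (p-1) % n + 1` and `j = (p-1)/n + 1`.) -/
def psiInf (n : ℕ) (Z : ℕ → ℕ → ℤ) : ℕ → ℤ := fun p =>
  if p = 0 then 0
  else if (p - 1) % n + 1 + ((p - 1) / n + 1) ≤ n + 1 then
    ∑ k ∈ Finset.Icc 1 ((p - 1) % n + 1),
      Z (n + 2 - ((p - 1) % n + 1) - ((p - 1) / n + 1)) k
  else 0

/-- Reverse semistandard Young tableaux of shape `λ` with entries in `{1, …, n+1}`: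
row `j` (for `1 ≤ j ≤ n`) has boxes in columns `1, …, λ_j`; entries are weakly
decreasing along rows and strictly decreasing down columns; `T` is `0` outside
the diagram. -/
def IsRSSYT (n : ℕ) (lam : ℕ → ℤ) (T : ℕ → ℕ → ℕ) : Prop :=
  (∀ j c : ℕ, 1 ≤ j → j ≤ n → 1 ≤ c → (c : ℤ) ≤ lam j → 1 ≤ T j c ∧ T j c ≤ n + 1) ∧
  (∀ j c : ℕ, 1 ≤ j → j ≤ n → 1 ≤ c → (c : ℤ) + 1 ≤ lam j → T j (c + 1) ≤ T j c) ∧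
  (∀ j c : ℕ, 1 ≤ j → j + 1 ≤ n → 1 ≤ c → (c : ℤ) ≤ lam (j + 1) → T (j + 1) c < T j c) ∧
  (∀ j c : ℕ, ¬(1 ≤ j ∧ j ≤ n ∧ 1 ≤ c ∧ (c : ℤ) ≤ lam j) → T j c = 0)

/-- `Λ_i^{(j)}(T) = #{ c : 1 ≤ c ≤ λ_j, T(j,c) ≥ i }`, as a natural number. -/
def LamTN (lam : ℕ → ℤ) (T : ℕ → ℕ → ℕ) (i j : ℕ) : ℕ :=
  ((Finset.Icc 1 (lam j).toNat).filter (fun c => i ≤ T j c)).card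

/-- `Λ_i^{(j)}(T)`, as an integer. -/
def LamT (lam : ℕ → ℤ) (T : ℕ → ℕ → ℕ) (i j : ℕ) : ℤ := (LamTN lam T i j : ℤ)

/-- The number of boxes of `T` containing the entry `i`. -/
def countEntry (n : ℕ) (lam : ℕ → ℤ) (T : ℕ → ℕ → ℕ) (i : ℕ) : ℤ :=
  ∑ j ∈ Finset.Icc 1 n,
    (((Finset.Icc 1 (lam j).toNat).filter (fun c => T j c = i)).card : ℤ)

/-- Gelfand–Tsetlin patterns of shape `λ`: `g i k` is `y_k^{(i)}`, defined for
`0 ≤ i ≤ n`, `1 ≤ k ≤ n+1-i` (and `0` outside this index range), with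
`y_k^{(0)} = λ_k` and the interlacing inequalities. -/
def IsGT (n : ℕ) (lam : ℕ → ℤ) (g : ℕ → ℕ → ℤ) : Prop :=
  (∀ i k, i ≤ n → 1 ≤ k → k ≤ n + 1 - i → 0 ≤ g i k) ∧
  (∀ k, 1 ≤ k → k ≤ n + 1 → g 0 k = lam k) ∧
  (∀ i k, 1 ≤ i → i ≤ n → 1 ≤ k → k ≤ n + 1 - i →
    g i k ≤ g (i - 1) k ∧ g (i - 1) (k + 1) ≤ g i k) ∧
  (∀ i k, ¬(i ≤ n ∧ 1 ≤ k ∧ k ≤ n + 1 - i) → g i k = 0)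

/-- `ς_λ(g)`: the sequence with `x_j^{(i)} = y_j^{(i)} - λ_{i+j}` for
`1 ≤ i ≤ n`, `1 ≤ j ≤ n+1-i`, and `0` otherwise. -/
def varsig (n : ℕ) (lam : ℕ → ℤ) (g : ℕ → ℕ → ℤ) : ℕ → ℤ := fun p =>
  if p = 0 then 0
  else if (p - 1) % n + 1 + ((p - 1) / n + 1) ≤ n + 1 then
    g ((p - 1) % n + 1) ((p - 1) / n + 1) - lam ((p - 1) % n + 1 + ((p - 1) / n + 1))
  else 0

/-- `σ_j^{(i)}(g) = y_j^{(i)} + 2 Σ_{k=j+1}^{n+1-i} y_k^{(i)} - Σ_{k=j}^{n-i} y_k^{(i+1)}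
- Σ_{k=j+1}^{n+2-i} y_k^{(i-1)}`, with the conventions `y_0^{(i)} = 0` and
out-of-range entries equal to `0`. -/
def sigGT (n : ℕ) (g : ℕ → ℕ → ℤ) (i j : ℕ) : ℤ :=
  (if 1 ≤ j ∧ j ≤ n + 1 - i then g i j else 0)
  + 2 * ∑ k ∈ Finset.Icc (j + 1) (n + 1 - i), g i k
  - ∑ k ∈ Finset.Icc (max j 1) (n - i), g (i + 1) k
  - ∑ k ∈ Finset.Icc (j + 1) (n + 2 - i), g (i - 1) k

/-- The array obtained from `g` by replacing `y_v^{(i)}` with `y_v^{(i)} + d`. -/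
def gUpdate (g : ℕ → ℕ → ℤ) (i v : ℕ) (d : ℤ) : ℕ → ℕ → ℤ :=
  fun i' k => if i' = i ∧ k = v then g i v + d else g i' k

/-- The z-array `Z_g` associated with `g ∈ GT_λ`:
`z(m,k) = y_{n+2-m-k}^{(k)} - y_{n+3-m-k}^{(k-1)}`. -/
def Zg (n : ℕ) (g : ℕ → ℕ → ℤ) (m k : ℕ) : ℤ :=
  if 1 ≤ m ∧ m ≤ n ∧ 1 ≤ k ∧ k ≤ n + 1 - m then
    g k (n + 2 - m - k) - g (k - 1) (n + 3 - m - k)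
  else 0

/-- The expression `x_j^{(i)} - x_j^{(i+1)} + 2 Σ_{k=j+1}^{n+1-i} x_k^{(i)}
- Σ_{k=j+1}^{n+2-i} x_k^{(i-1)} - Σ_{k=j+1}^{n-i} x_k^{(i+1)}`
(with `x^{(0)} = x^{(n+1)} = 0`). -/
def sigExpr (n : ℕ) (x : ℕ → ℤ) (i j : ℕ) : ℤ :=
  Xc n x i j - Xc n x (i + 1) j
  + 2 * ∑ k ∈ Finset.Icc (j + 1) (n + 1 - i), Xc n x i k
  - ∑ k ∈ Finset.Icc (j + 1) (n + 2 - i), Xc n x (i - 1) k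
  - ∑ k ∈ Finset.Icc (j + 1) (n - i), Xc n x (i + 1) k

lemma pos_mod (n j i : ℕ) (h1 : 1 ≤ i) (h2 : i ≤ n) : (j * n + i - 1) % n = i - 1 := by
  have : j * n + i - 1 = (i - 1) + n * j := by rw [Nat.mul_comm]; omega
  rw [this, Nat.add_mul_mod_self_left, Nat.mod_eq_of_lt (by omega)]

lemma pos_div (n j i : ℕ) (h1 : 1 ≤ i) (h2 : i ≤ n) : (j * n + i - 1) / n = j := by
  have : j * n + i - 1 = (i - 1) + n * j := by rw [Nat.mul_comm]; omega
  rw [this, Nat.add_mul_div_left _ _ (by omega), Nat.div_eq_of_lt (by omega)]; omega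

lemma pos_eq (n l : ℕ) (hl : 1 ≤ l) : l = (l - 1) / n * n + ((l - 1) % n + 1) := by
  have := Nat.div_add_mod (l - 1) n
  rw [Nat.mul_comm] at this
  omega

lemma col_pos (n j i : ℕ) (h1 : 1 ≤ i) (h2 : i ≤ n) : col n (j * n + i) = i := by
  unfold col; rw [pos_mod n j i h1 h2]; omega

/-- truncated shape -/
def Lt (n : ℕ) (lam : ℕ → ℤ) (m : ℕ) : ℤ := if m ≤ n + 1 then lam m else 0

lemma varsig_at (n : ℕ) (lam : ℕ → ℤ) (g : ℕ → ℕ → ℤ) (hg : IsGT n lam g) (j i : ℕ)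
    (h1 : 1 ≤ i) (h2 : i ≤ n) :
    varsig n lam g (j * n + i) = g i (j + 1) - Lt n lam (i + j + 1) := by
  unfold varsig Lt
  rw [pos_mod n j i h1 h2, pos_div n j i h1 h2, if_neg (by omega),
    show i - 1 + 1 = i by omega, show i + (j + 1) = i + j + 1 by omega]
  split_ifs with h
  · rfl
  · rw [hg.2.2.2 i (j + 1) (by omega)]; simp

lemma window (n i j : ℕ) (x : ℕ → ℤ) (h1 : 1 ≤ i) (h2 : i ≤ n) :
    ∑ l ∈ Finset.Ioc (j * n + i) (j * n + i + n), coef i (col n l) * x l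
      = 2 * x ((j + 1) * n + i) - (if i < n then x (j * n + (i + 1)) else 0)
        - (if 1 < i then x ((j + 1) * n + (i - 1)) else 0) := by
  have e1 : (j + 1) * n + i = j * n + i + n := by ring
  have e2 : (j + 1) * n = j * n + n := by ring
  have key : ∀ l ∈ Finset.Ioc (j * n + i) (j * n + i + n), coef i (col n l) * x l =
      (if l = j * n + i + n then 2 * x l else 0)
      + (if l = j * n + (i + 1) then (if i < n then - x l else 0) else 0)
      + (if l = j * n + n + (i - 1) then (if 1 < i then - x l else 0) else 0) := by
    intro l hl
    rw [Finset.mem_Ioc] at hl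
    obtain ⟨hl1, hl2⟩ := hl
    have hc : (l ≤ j * n + n ∧ col n l = l - j * n) ∨
        (j * n + n < l ∧ col n l = l - (j * n + n)) := by
      by_cases h : l ≤ j * n + n
      · left
        refine ⟨h, ?_⟩
        have := col_pos n j (l - j * n) (by omega) (by omega)
        rwa [show j * n + (l - j * n) = l by omega] at this
      · right
        refine ⟨by omega, ?_⟩
        have := col_pos n (j + 1) (l - (j * n + n)) (by omega) (by omega)
        rwa [e2, show j * n + n + (l - (j * n + n)) = l by omega] at this
    generalize col n l = c at *
    generalize j * n = q at *
    unfold coef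
    split_ifs <;> first | omega | (exfalso; omega) | ring
  rw [Finset.sum_congr rfl key, Finset.sum_add_distrib, Finset.sum_add_distrib,
    Finset.sum_ite_eq', Finset.sum_ite_eq', Finset.sum_ite_eq']
  simp only [Finset.mem_Ioc, e1, e2]
  generalize j * n = q at *
  split_ifs <;> first | omega | (exfalso; omega) | ring

lemma window0 (n i : ℕ) (x : ℕ → ℤ) (h1 : 1 ≤ i) (h2 : i ≤ n) :
    ∑ l ∈ Finset.Ioc 0 i, coef i (col n l) * x l
      = 2 * x i - (if 1 < i then x (i - 1) else 0) := by
  have key : ∀ l ∈ Finset.Ioc 0 i, coef i (col n l) * x l =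
      (if l = i then 2 * x l else 0)
      + (if l = i - 1 then (if 1 < i then - x l else 0) else 0) := by
    intro l hl
    rw [Finset.mem_Ioc] at hl
    obtain ⟨hl1, hl2⟩ := hl
    have hc := col_pos n 0 l (by omega) (by omega)
    simp only [Nat.zero_mul, Nat.zero_add] at hc
    rw [hc]
    unfold coef
    split_ifs <;> first | omega | (exfalso; omega) | ring
  rw [Finset.sum_congr rfl key, Finset.sum_add_distrib,
    Finset.sum_ite_eq', Finset.sum_ite_eq']
  simp only [Finset.mem_Ioc]
  split_ifs <;> first | omega | (exfalso; omega) | ring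

lemma sum_ext (N M a : ℕ) (f : ℕ → ℤ) (hNM : N ≤ M) (h : ∀ k, N < k → f k = 0) :
    ∑ k ∈ Finset.Icc a N, f k = ∑ k ∈ Finset.Icc a M, f k := by
  apply Finset.sum_subset (Finset.Icc_subset_Icc_right hNM)
  intro k hk hk'
  rw [Finset.mem_Icc] at hk hk'
  exact h k (by omega)

lemma sum_head (M a : ℕ) (f : ℕ → ℤ) (h : a ≤ M) :
    ∑ k ∈ Finset.Icc a M, f k = f a + ∑ k ∈ Finset.Icc (a + 1) M, f k := by
  rw [← Finset.add_sum_Ioc_eq_sum_Icc h]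
  congr 2
  ext k
  simp only [Finset.mem_Ioc, Finset.mem_Icc]
  omega

lemma sigGT_eq (n : ℕ) (lam : ℕ → ℤ) (g : ℕ → ℕ → ℤ) (hg : IsGT n lam g) (i j : ℕ)
    (h1 : 1 ≤ i) (h2 : i ≤ n) :
    sigGT n g i j = g i j + 2 * ∑ k ∈ Finset.Icc (j + 1) (n + 1), g i k
      - ∑ k ∈ Finset.Icc j (n + 1), g (i + 1) k
      - ∑ k ∈ Finset.Icc (j + 1) (n + 1), g (i - 1) k := by
  have hz := hg.2.2.2
  unfold sigGT
  have a1 : (if 1 ≤ j ∧ j ≤ n + 1 - i then g i j else 0) = g i j := by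
    split_ifs with h
    · rfl
    · rw [hz _ _ (by omega)]
  have a2 : ∑ k ∈ Finset.Icc (max j 1) (n - i), g (i + 1) k
      = ∑ k ∈ Finset.Icc j (n + 1), g (i + 1) k := by
    rw [sum_ext (n - i) (n + 1) _ _ (by omega) (fun k hk => hz _ _ (by omega))]
    rcases Nat.eq_zero_or_pos j with rfl | hj
    · rw [sum_head (n + 1) 0 _ (by omega), hz (i + 1) 0 (by omega)]; simp
    · rw [max_eq_left hj]
  rw [a1, a2, sum_ext (n + 1 - i) (n + 1) _ _ (by omega) (fun k hk => hz _ _ (by omega)),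
    sum_ext (n + 2 - i) (n + 1) _ _ (by omega) (fun k hk => hz _ _ (by omega))]

lemma sigGT_step (n : ℕ) (lam : ℕ → ℤ) (g : ℕ → ℕ → ℤ) (hg : IsGT n lam g) (i j : ℕ)
    (h1 : 1 ≤ i) (h2 : i ≤ n) (hj : j ≤ n) :
    sigGT n g i j = sigGT n g i (j + 1) + g i j + g i (j + 1) - g (i + 1) j
      - g (i - 1) (j + 1) := by
  rw [sigGT_eq n lam g hg i j h1 h2, sigGT_eq n lam g hg i (j + 1) h1 h2,
    sum_head (n + 1) j _ (by omega), sum_head (n + 1) (j + 1) (g i) (by omega),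
    sum_head (n + 1) (j + 1) (g (i - 1)) (by omega)]
  ring

lemma sigGT_big (n : ℕ) (lam : ℕ → ℤ) (g : ℕ → ℕ → ℤ) (hg : IsGT n lam g) (i j : ℕ)
    (h1 : 1 ≤ i) (h2 : i ≤ n) (hj : n + 1 - i < j) : sigGT n g i j = 0 := by
  have hz := hg.2.2.2
  rw [sigGT_eq n lam g hg i j h1 h2, hz i j (by omega)]
  rw [Finset.sum_eq_zero, Finset.sum_eq_zero, Finset.sum_eq_zero]
  · simp
  all_goals
    intro k hk
    rw [Finset.mem_Icc] at hk
    exact hz _ _ (by omega)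

lemma varsig_big (n : ℕ) (lam : ℕ → ℤ) (g : ℕ → ℕ → ℤ) (hn : 1 ≤ n) (l : ℕ) (hl : n * n < l) :
    varsig n lam g l = 0 := by
  unfold varsig
  have : n ≤ (l - 1) / n := by
    rw [Nat.le_div_iff_mul_le (by omega)]; omega
  rw [if_neg (by omega), if_neg (by omega)]

lemma sig_big (n : ℕ) (lam : ℕ → ℤ) (g : ℕ → ℕ → ℤ) (hn : 1 ≤ n) (k : ℕ) (hk : n * n < k) :
    sig n (varsig n lam g) k = 0 := by
  unfold sig
  rw [varsig_big n lam g hn k hk, Finset.sum_eq_zero]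
  · simp
  · intro l hl
    rw [Finset.mem_Ioc] at hl
    rw [varsig_big n lam g hn l (by omega)]; simp

lemma sig_step (n : ℕ) (x : ℕ → ℤ) (i j : ℕ)
    (h1 : 1 ≤ i) (h2 : i ≤ n) (hj : j < n) :
    sig n x (j * n + i) = sig n x ((j + 1) * n + i) + x (j * n + i) + x ((j + 1) * n + i)
       - (if i < n then x (j * n + (i + 1)) else 0)
       - (if 1 < i then x ((j + 1) * n + (i - 1)) else 0) := by
  have hw := window n i j x h1 h2
  have e : (j + 1) * n + i = j * n + i + n := by ring
  have hle : (j + 1) * n ≤ n * n := Nat.mul_le_mul_right n hj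
  unfold sig
  rw [col_pos n j i h1 h2, col_pos n (j + 1) i h1 h2,
    ← Finset.sum_Ioc_consecutive _ (show j * n + i ≤ j * n + i + n by omega)
      (show j * n + i + n ≤ n * n + n by omega), hw, e]
  ring

lemma sig_eq (n : ℕ) (hn : 1 ≤ n) (lam : ℕ → ℤ) (g : ℕ → ℕ → ℤ) (hg : IsGT n lam g) (i : ℕ)
    (h1 : 1 ≤ i) (h2 : i ≤ n) (d j : ℕ) (hd : j + d = n) :
    sig n (varsig n lam g) (j * n + i) = sigGT n g i (j + 1) := by
  have hz := hg.2.2.2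
  induction d generalizing j with
  | zero =>
    have : j = n := by omega
    subst this
    rw [sig_big j lam g hn _ (by omega), sigGT_big j lam g hg i _ h1 h2 (by omega)]
  | succ d ih =>
    rw [sig_step n _ i j h1 h2 (by omega), ih (j + 1) (by omega),
      sigGT_step n lam g hg i (j + 1) h1 h2 (by omega),
      varsig_at n lam g hg j i h1 h2, varsig_at n lam g hg (j + 1) i h1 h2]
    have b1 : (if i < n then varsig n lam g (j * n + (i + 1)) else 0)
        = g (i + 1) (j + 1) - Lt n lam (i + (j + 1) + 1) := by
      split_ifs with h
      · rw [varsig_at n lam g hg j (i + 1) (by omega) (by omega)]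
        congr 2; omega
      · rw [hz _ _ (by omega)]
        unfold Lt
        rw [if_neg (by omega)]; simp
    have b2 : (if 1 < i then varsig n lam g ((j + 1) * n + (i - 1)) else 0)
        = g (i - 1) (j + 2) - Lt n lam (i + j + 1) := by
      split_ifs with h
      · rw [varsig_at n lam g hg (j + 1) (i - 1) (by omega) (by omega)]
        congr 2; omega
      · have : i = 1 := by omega
        subst this
        unfold Lt
        rw [if_pos (by omega), show 1 - 1 = 0 from rfl, hg.2.1 _ (by omega) (by omega),
          show 1 + j + 1 = j + 2 by omega]; simp
    rw [b1, b2]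
    ring

lemma sigma0_eq (n : ℕ) (hn : 1 ≤ n) (lam : ℕ → ℤ) (g : ℕ → ℕ → ℤ) (hg : IsGT n lam g) (i : ℕ)
    (h1 : 1 ≤ i) (h2 : i ≤ n) :
    sigma0 n lam (varsig n lam g) i = sigGT n g i 0 := by
  have hz := hg.2.2.2
  have hs := sig_eq n hn lam g hg i h1 h2 n 0 (by omega)
  have hw := window0 n i (varsig n lam g) h1 h2
  have hv := varsig_at n lam g hg 0 i h1 h2
  have hc := col_pos n 0 i h1 h2
  simp only [Nat.zero_mul, Nat.zero_add, Nat.add_zero] at hs hv hc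
  rw [sigGT_step n lam g hg i 0 h1 h2 (by omega), hz i 0 (by omega), hz (i + 1) 0 (by omega)]
  simp only [Nat.zero_add]
  rw [← hs]
  unfold sigma0 sig
  rw [hc, show Finset.Icc 1 (n * n + n) = Finset.Ioc 0 (n * n + n) from rfl,
    ← Finset.sum_Ioc_consecutive _ (show 0 ≤ i by omega)
      (show i ≤ n * n + n by omega), hw, hv]
  have b2 : (if 1 < i then varsig n lam g (i - 1) else 0) = g (i - 1) 1 - lam i := by
    split_ifs with h
    · have := varsig_at n lam g hg 0 (i - 1) (by omega) (by omega)
      simp only [Nat.zero_mul, Nat.zero_add, Nat.add_zero] at this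
      rw [this]
      unfold Lt
      rw [if_pos (by omega), show i - 1 + 1 = i by omega]
    · have : i = 1 := by omega
      subst this
      rw [show 1 - 1 = 0 from rfl, hg.2.1 _ (by omega) (by omega)]; simp
  rw [b2]
  unfold Lt
  rw [if_pos (by omega)]
  ring

lemma upd (n : ℕ) (hn : 1 ≤ n) (lam : ℕ → ℤ) (g : ℕ → ℕ → ℤ) (i v : ℕ) (d : ℤ)
    (h1 : 1 ≤ i) (h2 : i ≤ n) (hv1 : 1 ≤ v) (hv : v ≤ n + 1 - i) (l : ℕ) :
    varsig n lam g l + d * eVec ((v - 1) * n + i) l = varsig n lam (gUpdate g i v d) l := by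
  unfold varsig eVec gUpdate
  by_cases hl : l = (v - 1) * n + i
  · rw [hl, pos_mod n (v - 1) i h1 h2, pos_div n (v - 1) i h1 h2]
    rw [show i - 1 + 1 = i by omega, show v - 1 + 1 = v by omega]
    rw [if_neg (by omega), if_pos (by omega), if_pos rfl, if_neg (by omega), if_pos (by omega),
      if_pos ⟨rfl, rfl⟩]
    ring
  · rw [if_neg hl]
    by_cases h0 : l = 0
    · simp [h0]
    · have hp := pos_eq n l (by omega)
      have : ¬ ((l - 1) % n + 1 = i ∧ (l - 1) / n + 1 = v) := by
        rintro ⟨ha, hb⟩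
        apply hl
        rw [hp, ha, ← hb]
        simp
      rw [if_neg this]
      simp

lemma last_nonneg (n : ℕ) (lam : ℕ → ℤ) (g : ℕ → ℕ → ℤ) (hg : IsGT n lam g) (i : ℕ)
    (h1 : 1 ≤ i) (h2 : i ≤ n) : 0 ≤ sigGT n g i (n + 1 - i) := by
  have hz := hg.2.2.2
  rw [sigGT_step n lam g hg i _ h1 h2 (by omega),
    sigGT_big n lam g hg i _ h1 h2 (by omega), hz i (n + 1 - i + 1) (by omega),
    hz (i + 1) (n + 1 - i) (by omega)]
  have := (hg.2.2.1 i (n + 1 - i) h1 h2 (by omega) le_rfl).2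
  linarith

/-- let `g ∈ GT_λ`, `x = ς_λ(g)`, `1 ≤ i ≤ n`, and let
`s = max_{1 ≤ j ≤ n} σ_j^{(i)}(g)`.
(a) If `s > 0` and `v` is the largest `j ∈ {1, …, n}` with `σ_j^{(i)}(g) = s`, then
`σ^{(i)}(x) > 0`, `max M^{(i)}(x) = (v-1)n + i`, and
`x - e_{(v-1)n+i} = ς_λ(g')` where `g'` replaces `y_v^{(i)}` with `y_v^{(i)} - 1`.
(b) If `s > σ_0^{(i)}(g)` and `w` is the smallest such `j`, then
`σ^{(i)}(x) > σ_0^{(i)}(x)`, `min M^{(i)}(x) = (w-1)n + i`, and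
`x + e_{(w-1)n+i} = ς_λ(g'')` where `g''` replaces `y_w^{(i)}` with `y_w^{(i)} + 1`. -/
theorem stmt11 (n : ℕ) (hn : 1 ≤ n) (lam : ℕ → ℤ) (hlam : IsShape n lam)
    (g : ℕ → ℕ → ℤ) (hg : IsGT n lam g) (x : ℕ → ℤ) (hx : x = varsig n lam g)
    (i : ℕ) (hi1 : 1 ≤ i) (hin : i ≤ n)
    (s : ℤ)
    (hs : s = Finset.sup' (Finset.Icc 1 n) (Finset.nonempty_Icc.mpr hn) (sigGT n g i)) :
    (∀ v : ℕ, 0 < s →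
      (1 ≤ v ∧ v ≤ n ∧ sigGT n g i v = s ∧
        (∀ j, 1 ≤ j → j ≤ n → sigGT n g i j = s → j ≤ v)) →
      0 < sigmaI n x i ∧ sSup (Mset n x i) = (v - 1) * n + i ∧
        (fun l => x l - eVec ((v - 1) * n + i) l)
          = varsig n lam (gUpdate g i v (-1))) ∧
    (∀ w : ℕ, sigGT n g i 0 < s →
      (1 ≤ w ∧ w ≤ n ∧ sigGT n g i w = s ∧
        (∀ j, 1 ≤ j → j ≤ n → sigGT n g i j = s → w ≤ j)) →
      sigma0 n lam x i < sigmaI n x i ∧ sInf (Mset n x i) = (w - 1) * n + i ∧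
        (fun l => x l + eVec ((w - 1) * n + i) l)
          = varsig n lam (gUpdate g i w 1)) := by
  have hz := hg.2.2.2
  have hle : ∀ j, 1 ≤ j → j ≤ n → sigGT n g i j ≤ s := by
    intro j hj1 hj2
    rw [hs]
    exact Finset.le_sup' (sigGT n g i) (Finset.mem_Icc.mpr ⟨hj1, hj2⟩)
  have hlast := last_nonneg n lam g hg i hi1 hin
  have hs0 : 0 ≤ s := hlast.trans (hle _ (by omega) (by omega))
  have hsig : ∀ j, 1 ≤ j → j ≤ n + 1 → sig n x ((j - 1) * n + i) = sigGT n g i j := by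
    intro j hj1 hj2
    rw [hx, sig_eq n hn lam g hg i hi1 hin (n + 1 - j) (j - 1) (by omega),
      show j - 1 + 1 = j by omega]
  have hI : ∀ v, 1 ≤ v → v ≤ n → sigGT n g i v = s → sigmaI n x i = s := by
    intro v hv1 hv2 hv
    unfold sigmaI
    apply le_antisymm
    · apply Finset.sup'_le
      intro j hj
      rw [Finset.mem_Icc] at hj
      rw [hsig j hj.1 hj.2]
      by_cases hjn : j ≤ n
      · exact hle j hj.1 hjn
      · rw [sigGT_big n lam g hg i j hi1 hin (by omega)]; exact hs0
    · rw [← hv, ← hsig v hv1 (by omega)]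
      exact Finset.le_sup' (fun j => sig n x ((j - 1) * n + i))
        (Finset.mem_Icc.mpr ⟨hv1, by omega⟩)
  have hM : ∀ k, 1 ≤ k → col n k = i → ∃ q, k = q * n + i := by
    intro k hk hc
    have := pos_eq n k hk
    unfold col at hc
    rw [hc] at this
    exact ⟨_, this⟩
  refine ⟨?_, ?_⟩
  · rintro v hpos ⟨hv1, hv2, hv, hmax⟩
    have hIs := hI v hv1 hv2 hv
    have hvi : v ≤ n + 1 - i := by
      by_contra h
      rw [sigGT_big n lam g hg i v hi1 hin (by omega)] at hv
      omega
    refine ⟨by rw [hIs]; exact hpos, ?_, ?_⟩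
    · apply IsGreatest.csSup_eq
      refine ⟨⟨by omega, col_pos n _ i hi1 hin, by rw [hsig v hv1 (by omega), hv, hIs]⟩, ?_⟩
      rintro k ⟨hk1, hk2, hk3⟩
      obtain ⟨q, hk⟩ := hM k hk1 hk2
      rw [hIs] at hk3
      have hkn : q < n := by
        by_contra h
        have : n * n ≤ q * n := Nat.mul_le_mul_right n (by omega)
        rw [hx, sig_big n lam g hn k (by omega)] at hk3
        omega
      have h3 := hsig (q + 1) (by omega) (by omega)
      rw [show q + 1 - 1 = q by omega, ← hk, hk3] at h3
      have h4 := hmax _ (by omega) (by omega) h3.symm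
      have : q * n ≤ (v - 1) * n := Nat.mul_le_mul_right n (by omega)
      omega
    · funext l
      rw [← upd n hn lam g i v (-1) hi1 hin hv1 hvi l, hx]
      ring
  · rintro w hpos ⟨hw1, hw2, hw, hmin⟩
    have hIs := hI w hw1 hw2 hw
    have hwi : w ≤ n + 1 - i := by
      by_contra h
      rw [sigGT_big n lam g hg i w hi1 hin (by omega)] at hw
      have h1 := hle (n + 1 - i) (by omega) (by omega)
      have := hmin (n + 1 - i) (by omega) (by omega) (by omega)
      omega
    refine ⟨by rw [hIs, hx, sigma0_eq n hn lam g hg i hi1 hin]; exact hpos, ?_, ?_⟩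
    · apply IsLeast.csInf_eq
      refine ⟨⟨by omega, col_pos n _ i hi1 hin, by rw [hsig w hw1 (by omega), hw, hIs]⟩, ?_⟩
      rintro k ⟨hk1, hk2, hk3⟩
      obtain ⟨q, hk⟩ := hM k hk1 hk2
      rw [hIs] at hk3
      have hwk : w - 1 ≤ q := by
        by_cases hkn : q < n
        · have h3 := hsig (q + 1) (by omega) (by omega)
          rw [show q + 1 - 1 = q by omega, ← hk, hk3] at h3
          have h4 := hmin _ (by omega) (by omega) h3.symm
          omega
        · omega
      have : (w - 1) * n ≤ q * n := Nat.mul_le_mul_right n hwk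
      omega
    · funext l
      rw [← upd n hn lam g i w 1 hi1 hin hw1 hwi l, hx]
      ring

end PolyReal
end

section
/- Let g ∈ GT_λ and 1 ≤ i ≤ n, and set ε_i(g) := max_{1 ≤ j ≤ n} σ_j^{(i)}(g). (a) If ε_i(g) > 0 and v = max{ j ∈ {1,…,n} : σ_j^{(i)}(g) = ε_i(g) }, then the array obtained from g by replacing y_v^{(i)} with y_v^{(i)} − 1 is again a Gelfand–Tsetlin pattern of shape λ. (b) If ε_i(g) > σ_0^{(i)}(g) and w = min{ j ∈ {1,…,n} : σ_j^{(i)}(g) = ε_i(g) }, then the array obtained from g by replacing y_w^{(i)} with y_w^{(i)} + 1 is again a Gelfand–Tsetlin pattern of shape λ. -/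
namespace PolyReal

theorem sigGT_succ_aux (n : ℕ) (lam : ℕ → ℤ) (g : ℕ → ℕ → ℤ) (hg : IsGT n lam g) (i j : ℕ)
    (hi : 1 ≤ i) (hin : i ≤ n) (hj : 1 ≤ j) (hjn : j ≤ n + 1 - i) :
    sigGT n g i j = sigGT n g i (j + 1) + g i j + g i (j + 1) - g (i + 1) j - g (i - 1) (j + 1) := by
  obtain ⟨-, -, -, h0⟩ := hg
  have key : ∀ (a b : ℕ) (f : ℕ → ℤ), a ≤ b →
      ∑ k ∈ Finset.Icc a b, f k = f a + ∑ k ∈ Finset.Icc (a + 1) b, f k := by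
    intro a b f hab
    rw [← Finset.insert_Icc_add_one_left_eq_Icc hab, Finset.sum_insert (by simp)]
  unfold sigGT
  rw [max_eq_left hj, max_eq_left (by omega : 1 ≤ j + 1), key (j + 1) (n + 2 - i) _ (by omega)]
  rcases Nat.lt_or_ge j (n + 1 - i) with h | h
  · rw [key (j + 1) (n + 1 - i) _ (by omega), key j (n - i) _ (by omega),
      if_pos ⟨hj, hjn⟩, if_pos ⟨by omega, by omega⟩]
    ring
  · rw [Finset.Icc_eq_empty (by omega : ¬ j + 1 ≤ n + 1 - i),
      Finset.Icc_eq_empty (by omega : ¬ j + 1 + 1 ≤ n + 1 - i),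
      Finset.Icc_eq_empty (by omega : ¬ j ≤ n - i),
      Finset.Icc_eq_empty (by omega : ¬ j + 1 ≤ n - i),
      if_pos ⟨hj, hjn⟩, if_neg (by omega), h0 i (j + 1) (by omega), h0 (i + 1) j (by omega)]
    simp
    ring

theorem sigGT_zero_aux (n : ℕ) (g : ℕ → ℕ → ℤ) (i : ℕ)
    (hi : 1 ≤ i) (hin : i ≤ n) :
    sigGT n g i 0 = sigGT n g i 1 + g i 1 - g (i - 1) 1 := by
  have key : ∀ (a b : ℕ) (f : ℕ → ℤ), a ≤ b →
      ∑ k ∈ Finset.Icc a b, f k = f a + ∑ k ∈ Finset.Icc (a + 1) b, f k := by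
    intro a b f hab
    rw [← Finset.insert_Icc_add_one_left_eq_Icc hab, Finset.sum_insert (by simp)]
  unfold sigGT
  rw [key (0 + 1) (n + 2 - i) _ (by omega), key (0 + 1) (n + 1 - i) _ (by omega),
    if_neg (by omega), if_pos ⟨by omega, by omega⟩]
  simp
  ring

theorem sigGT_large_aux (n : ℕ) (g : ℕ → ℕ → ℤ) (i j : ℕ)
    (hin : i ≤ n) (hj : n + 1 - i < j) : sigGT n g i j = 0 := by
  unfold sigGT
  rw [if_neg (by omega), Finset.Icc_eq_empty (by omega : ¬ j + 1 ≤ n + 1 - i),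
      Finset.Icc_eq_empty (by omega : ¬ j + 1 ≤ n + 2 - i),
      Finset.Icc_eq_empty (by omega : ¬ max j 1 ≤ n - i)]
  simp

theorem isGT_update_aux (n : ℕ) (lam : ℕ → ℤ) (g : ℕ → ℕ → ℤ) (hg : IsGT n lam g) (i v : ℕ) (d : ℤ)
    (hi : 1 ≤ i) (hin : i ≤ n) (hv : 1 ≤ v) (hvn : v ≤ n + 1 - i)
    (h1 : g i v + d ≤ g (i - 1) v) (h2 : g (i - 1) (v + 1) ≤ g i v + d)
    (h3 : v ≤ n - i → g (i + 1) v ≤ g i v + d)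
    (h4 : 2 ≤ v → g i v + d ≤ g (i + 1) (v - 1)) : IsGT n lam (gUpdate g i v d) := by
  obtain ⟨a, b, c, e⟩ := hg
  have hnn : 0 ≤ g (i - 1) (v + 1) := a _ _ (by omega) (by omega) (by omega)
  refine ⟨?_, ?_, ?_, ?_⟩
  · intro i' k x y z
    unfold gUpdate
    split_ifs
    · omega
    · exact a _ _ x y z
  · intro k x y
    unfold gUpdate
    rw [if_neg (by omega)]
    exact b k x y
  · intro i' k x y z w
    have hc := c i' k x y z w
    unfold gUpdate
    by_cases hii : i' = i
    · subst hii
      rw [if_neg (by omega : ¬ (i' - 1 = i' ∧ k = v)),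
        if_neg (by omega : ¬ (i' - 1 = i' ∧ k + 1 = v))]
      split_ifs with hk
      · obtain ⟨-, rfl⟩ := hk
        exact ⟨h1, h2⟩
      · exact hc
    · rw [if_neg (by omega : ¬ (i' = i ∧ k = v))]
      by_cases hi2 : i' = i + 1
      · subst hi2
        simp only [Nat.add_sub_cancel] at hc ⊢
        constructor
        · split_ifs with hk
          · obtain ⟨-, rfl⟩ := hk
            exact h3 (by omega)
          · exact hc.1
        · split_ifs with hk
          · obtain ⟨-, rfl⟩ := hk
            exact h4 (by omega)
          · exact hc.2
      · rw [if_neg (by omega), if_neg (by omega)]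
        exact hc
  · intro i' k x
    unfold gUpdate
    rw [if_neg (by rintro ⟨rfl, rfl⟩; omega)]
    exact e _ _ x

/-- let `g ∈ GT_λ`, `1 ≤ i ≤ n`, and `ε_i(g) = max_{1 ≤ j ≤ n} σ_j^{(i)}(g)`.
(a) If `ε_i(g) > 0` and `v` is the largest `j ∈ {1,…,n}` with `σ_j^{(i)}(g) = ε_i(g)`,
then replacing `y_v^{(i)}` with `y_v^{(i)} - 1` yields again a GT pattern of shape `λ`.
(b) If `ε_i(g) > σ_0^{(i)}(g)` and `w` is the smallest such `j`, then replacing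
`y_w^{(i)}` with `y_w^{(i)} + 1` yields again a GT pattern of shape `λ`. -/
theorem stmt12 (n : ℕ) (hn : 1 ≤ n) (lam : ℕ → ℤ) (hlam : IsShape n lam)
    (g : ℕ → ℕ → ℤ) (hg : IsGT n lam g) (i : ℕ) (hi1 : 1 ≤ i) (hin : i ≤ n)
    (eps : ℤ)
    (heps : eps = Finset.sup' (Finset.Icc 1 n) (Finset.nonempty_Icc.mpr hn) (sigGT n g i)) :
    (∀ v : ℕ, 0 < eps →
      (1 ≤ v ∧ v ≤ n ∧ sigGT n g i v = eps ∧
        (∀ j, 1 ≤ j → j ≤ n → sigGT n g i j = eps → j ≤ v)) →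
      IsGT n lam (gUpdate g i v (-1))) ∧
    (∀ w : ℕ, sigGT n g i 0 < eps →
      (1 ≤ w ∧ w ≤ n ∧ sigGT n g i w = eps ∧
        (∀ j, 1 ≤ j → j ≤ n → sigGT n g i j = eps → w ≤ j)) →
      IsGT n lam (gUpdate g i w 1)) := by
  have hle : ∀ j, 1 ≤ j → j ≤ n → sigGT n g i j ≤ eps := by
    intro j h1 h2
    rw [heps]
    exact Finset.le_sup' (sigGT n g i) (Finset.mem_Icc.mpr ⟨h1, h2⟩)
  have hg' := hg
  obtain ⟨a, b, c, e⟩ := hg'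
  constructor
  · rintro v hpos ⟨hv1, hvn, hve, hmax⟩
    have hvr : v ≤ n + 1 - i := by
      by_contra h
      have := sigGT_large_aux n g i v hin (by omega)
      omega
    have hlt : sigGT n g i (v + 1) < eps := by
      by_cases h : v + 1 ≤ n
      · refine lt_of_le_of_ne (hle _ (by omega) h) fun h' => ?_
        have := hmax _ (by omega) h h'
        omega
      · rw [sigGT_large_aux n g i (v + 1) hin (by omega)]
        exact hpos
    have hs := sigGT_succ_aux n lam g hg i v hi1 hin hv1 hvr
    have hc := c i v hi1 hin hv1 hvr
    have hA : g (i + 1) v ≥ g i (v + 1) := by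
      by_cases h : v ≤ n - i
      · exact (c (i + 1) v (by omega) (by omega) hv1 (by omega)).2
      · rw [e (i + 1) v (by omega), e i (v + 1) (by omega)]
    refine isGT_update_aux n lam g hg i v (-1) hi1 hin hv1 hvr (by omega) (by omega) ?_ ?_
    · intro h
      have := (c i (v + 1) hi1 hin (by omega) (by omega)).1
      omega
    · intro h
      have := (c (i + 1) (v - 1) (by omega) (by omega) (by omega) (by omega)).2
      rw [Nat.add_sub_cancel, Nat.sub_add_cancel hv1] at this
      omega
  · rintro w hpos ⟨hw1, hwn, hwe, hmin⟩
    have hwr : w ≤ n + 1 - i := by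
      by_contra h
      have h0 := sigGT_large_aux n g i w hin (by omega)
      have hs := sigGT_succ_aux n lam g hg i (n + 1 - i) hi1 hin (by omega) le_rfl
      rw [sigGT_large_aux n g i (n + 1 - i + 1) hin (by omega), e i (n + 1 - i + 1) (by omega),
        e (i + 1) (n + 1 - i) (by omega)] at hs
      have hc := (c i (n + 1 - i) hi1 hin (by omega) le_rfl).2
      have hl := hle (n + 1 - i) (by omega) (by omega)
      have := hmin (n + 1 - i) (by omega) (by omega) (by omega)
      omega
    have hc := c i w hi1 hin hw1 hwr
    have h3 : w ≤ n - i → g (i + 1) w ≤ g i w + 1 := by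
      intro h
      have := (c (i + 1) w (by omega) (by omega) hw1 (by omega)).1
      rw [Nat.add_sub_cancel] at this
      omega
    obtain ⟨j, rfl⟩ : ∃ j, w = j + 1 := ⟨w - 1, by omega⟩
    rcases Nat.eq_zero_or_pos j with rfl | hj
    · have hs := sigGT_zero_aux n g i hi1 hin
      simp only [Nat.zero_add] at *
      exact isGT_update_aux n lam g hg i 1 1 hi1 hin hw1 hwr (by omega) (by omega) h3
        (by omega)
    · have hlt : sigGT n g i j < eps := by
        refine lt_of_le_of_ne (hle _ hj (by omega)) fun h' => ?_
        have := hmin _ hj (by omega) h'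
        omega
      have hs := sigGT_succ_aux n lam g hg i j hi1 hin hj (by omega)
      have hc1 := c i j hi1 hin hj (by omega)
      have hc2 := (c (i + 1) j (by omega) (by omega) hj (by omega)).1
      rw [Nat.add_sub_cancel] at hc2
      refine isGT_update_aux n lam g hg i (j + 1) 1 hi1 hin hw1 hwr (by omega) (by omega) h3 ?_
      intro _
      rw [Nat.add_sub_cancel]
      omega


end PolyReal
end

section
/- Let x ∈ Σ_ι[λ] and 1 ≤ i ≤ n. (a) If σ^{(i)}(x) > σ_0^{(i)}(x), then x + e_k ∈ Σ_ι[λ], where k = min M^{(i)}(x). (b) If σ^{(i)}(x) > 0, then x − e_{k'} ∈ Σ_ι[λ], where k' = max M^{(i)}(x). (Here e_k denotes the sequence that is 1 in position k and 0 elsewhere.) -/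
namespace PolyReal

theorem col_block (n q i : ℕ) (hi1 : 1 ≤ i) (hin : i ≤ n) : col n (q * n + i) = i := by
  unfold col
  have : q * n + i - 1 = (i - 1) + n * q := by rw [Nat.mul_comm]; omega
  rw [this, Nat.add_mul_mod_self_left, Nat.mod_eq_of_lt (by omega)]; omega

theorem Xc_succ (n : ℕ) (x : ℕ → ℤ) (i q : ℕ) :
    Xc n x i (q + 1) = if 1 ≤ i ∧ i ≤ n then x (q * n + i) else 0 := by
  unfold Xc; simp

theorem pos_decomp (n k : ℕ) (hn : 1 ≤ n) (hk : 1 ≤ k) : ∃ q, k = q * n + col n k := by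
  refine ⟨(k - 1) / n, ?_⟩
  unfold col
  have := Nat.div_add_mod' (k - 1) n
  omega

theorem pos_inj (n q q' a b : ℕ) (ha : 1 ≤ a) (han : a ≤ n) (hb : 1 ≤ b) (hbn : b ≤ n)
    (h : q * n + a = q' * n + b) : q = q' ∧ a = b := by
  have h1 := col_block n q a ha han
  have h2 := col_block n q' b hb hbn
  rw [h, h2] at h1
  subst h1
  refine ⟨?_, rfl⟩
  have : q * n = q' * n := by omega
  exact Nat.eq_of_mul_eq_mul_right (by omega) this

theorem sig_diff (n : ℕ) (x : ℕ → ℤ) (i q : ℕ) (hi1 : 1 ≤ i) (hin : i ≤ n) (hq : q < n) :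
    sig n x (q * n + i) - sig n x ((q + 1) * n + i) =
      Xc n x i (q + 1) + Xc n x i (q + 2) - Xc n x (i + 1) (q + 1) - Xc n x (i - 1) (q + 2) := by
  have hle : q * n + n + i ≤ n * n + n := by nlinarith
  unfold sig
  rw [col_block n q i hi1 hin, col_block n (q+1) i hi1 hin, show q + 2 = (q + 1) + 1 from rfl]
  simp only [Xc_succ]
  rw [show (q + 1) * n = q * n + n by ring]
  have hs : ∑ l ∈ Finset.Ioc (q * n + i) (n * n + n), coef i (col n l) * x l =
      ∑ l ∈ Finset.Ioc (q * n + i) (q * n + n + i), coef i (col n l) * x l +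
      ∑ l ∈ Finset.Ioc (q * n + n + i) (n * n + n), coef i (col n l) * x l :=
    (Finset.sum_Ioc_consecutive _ (by omega) hle).symm
  have hb : ∑ l ∈ Finset.Ioc (q * n + i) (q * n + n + i), coef i (col n l) * x l =
      ∑ l ∈ Finset.Ioc (q * n + i) (q * n + n + i),
        ((if l = q * n + n + i then 2 * x l else 0) +
         (if l = q * n + (i + 1) then (if i + 1 ≤ n then - x l else 0) else 0) +
         (if l = q * n + n + (i - 1) then (if 1 ≤ i - 1 then - x l else 0) else 0)) := by
    apply Finset.sum_congr rfl
    intro l hl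
    rw [Finset.mem_Ioc] at hl
    obtain ⟨t, rfl⟩ : ∃ t, l = q * n + t := ⟨l - q * n, by omega⟩
    by_cases ht : t ≤ n
    · rw [col_block n q t (by omega) ht]
      unfold coef
      generalize q * n = Q at *
      split_ifs <;> first | omega | (ring_nf)
    · obtain ⟨u, rfl⟩ : ∃ u, t = n + u := ⟨t - n, by omega⟩
      rw [show q * n + (n + u) = (q + 1) * n + u by ring, col_block n (q + 1) u (by omega) (by omega)]
      rw [show (q + 1) * n = q * n + n by ring]
      unfold coef
      generalize q * n = Q at *
      split_ifs <;> first | omega | (ring_nf)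
  rw [hs, hb, Finset.sum_add_distrib, Finset.sum_add_distrib, Finset.sum_ite_eq', Finset.sum_ite_eq',
    Finset.sum_ite_eq']
  simp only [Finset.mem_Ioc]
  generalize q * n = Q at *
  split_ifs <;> first | omega | (ring_nf)

theorem sigma0_eq_s13 (n : ℕ) (lam x : ℕ → ℤ) (i : ℕ) (hi1 : 1 ≤ i) (hin : i ≤ n) :
    sigma0 n lam x i = sig n x i + Xc n x i 1 - Xc n x (i - 1) 1 - (lam i - lam (i + 1)) := by
  have hc : ∀ t, 1 ≤ t → t ≤ n → col n t = t := fun t h1 h2 => by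
    have := col_block n 0 t h1 h2
    simpa using this
  unfold sigma0 sig
  rw [hc i hi1 hin, show (1 : ℕ) = 0 + 1 from rfl]
  simp only [Xc_succ]
  have h0 : Finset.Icc (0 + 1) (n * n + n) = Finset.Ioc 0 (n * n + n) := by
    ext; simp [Finset.mem_Icc, Finset.mem_Ioc]; omega
  have hs : ∑ l ∈ Finset.Ioc 0 (n * n + n), coef i (col n l) * x l =
      ∑ l ∈ Finset.Ioc 0 i, coef i (col n l) * x l +
      ∑ l ∈ Finset.Ioc i (n * n + n), coef i (col n l) * x l :=
    (Finset.sum_Ioc_consecutive _ (by omega) (by nlinarith)).symm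
  have hb : ∑ l ∈ Finset.Ioc 0 i, coef i (col n l) * x l =
      ∑ l ∈ Finset.Ioc 0 i,
        ((if l = i then 2 * x l else 0) + (if l = i - 1 then - x l else 0)) := by
    apply Finset.sum_congr rfl
    intro l hl
    rw [Finset.mem_Ioc] at hl
    rw [hc l (by omega) (by omega)]
    unfold coef
    split_ifs <;> first | omega | (ring_nf)
  rw [h0, hs, hb, Finset.sum_add_distrib, Finset.sum_ite_eq', Finset.sum_ite_eq']
  simp only [Finset.mem_Ioc, Nat.zero_mul, Nat.zero_add]
  split_ifs <;> first | omega | (ring_nf)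

/-- Normalised form of membership. -/
def Nice (n : ℕ) (lam : ℕ → ℤ) (X : ℕ → ℕ → ℤ) : Prop :=
  (∀ a q, X a (q + 2) ≤ X (a + 1) (q + 1)) ∧
  (∀ a q, a + q < n →
    X (a + 1) (q + 1) - X a (q + 1) ≤ lam (a + q + 1) - lam (a + q + 2)) ∧
  (∀ a q, n < a + q → X a (q + 1) = 0)

theorem nice_of (n : ℕ) (lam x : ℕ → ℤ) (hx : InSigmaL n lam x) : Nice n lam (Xc n x) := by
  obtain ⟨⟨-, h1, h2⟩, h3⟩ := hx
  have hz : ∀ a q, n < a + q → Xc n x a (q + 1) = 0 := by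
    intro a q h
    by_cases ha : 1 ≤ a ∧ a ≤ n
    · exact h2 a (q + 1) ha.1 ha.2 (by omega) (by omega)
    · rw [Xc_succ, if_neg ha]
  refine ⟨?_, ?_, hz⟩
  · intro a q
    by_cases h : a + q < n
    · have := h1 (a + q + 1) (q + 1) (by omega) (by omega) (by omega) (by omega)
      rwa [show a + q + 1 - (q + 1) = a by omega, show a + q + 1 + 1 - (q + 1) = a + 1 by omega] at this
    · rw [hz a (q + 1) (by omega), hz (a + 1) q (by omega)]
  · intro a q h
    have := h3 (a + q + 1) (q + 1) (by omega) (by omega) (by omega)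
    rwa [show a + q + 1 - (q + 1) = a by omega] at this

theorem of_nice (n : ℕ) (lam x : ℕ → ℤ) (h0 : x 0 = 0) (h : Nice n lam (Xc n x)) :
    InSigmaL n lam x := by
  obtain ⟨h1, h2, h3⟩ := h
  refine ⟨⟨h0, ?_, ?_⟩, ?_⟩
  · intro i k _ hi hk hki
    have := h1 (i - k) (k - 1)
    rwa [show k - 1 + 2 = k + 1 by omega, show k - 1 + 1 = k by omega,
      show i - k + 1 = i + 1 - k by omega] at this
  · intro i j _ _ hj hij
    have := h3 i (j - 1) (by omega)
    rwa [show j - 1 + 1 = j by omega] at this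
  · intro i j hj hji hi
    have := h2 (i - j) (j - 1) (by omega)
    rwa [show j - 1 + 1 = j by omega, show i - j + (j - 1) + 1 = i by omega,
      show i - j + (j - 1) + 2 = i + 1 by omega] at this

theorem x_zero (n : ℕ) (hn : 1 ≤ n) (lam x : ℕ → ℤ) (hx : InSigmaL n lam x) (k : ℕ)
    (hk : n * n < k) : x k = 0 := by
  obtain ⟨q, hq⟩ := pos_decomp n k hn (by omega)
  have hc1 : 1 ≤ col n k := by unfold col; omega
  have hc2 : col n k ≤ n := by
    unfold col; have := Nat.mod_lt (k - 1) (show 0 < n by omega); omega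
  have hqn : n ≤ q := by
    by_contra hlt
    have : (q + 1) * n ≤ n * n := Nat.mul_le_mul_right n (by omega)
    rw [Nat.add_mul] at this
    omega
  have := (nice_of n lam x hx).2.2 (col n k) q (by omega)
  rw [Xc_succ, if_pos ⟨hc1, hc2⟩, ← hq] at this
  exact this

theorem sig_zero (n : ℕ) (hn : 1 ≤ n) (lam x : ℕ → ℤ) (hx : InSigmaL n lam x) (k : ℕ)
    (hk : n * n < k) : sig n x k = 0 := by
  unfold sig
  rw [x_zero n hn lam x hx k hk, Finset.sum_eq_zero]
  · rfl
  · intro l hl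
    rw [Finset.mem_Ioc] at hl
    rw [x_zero n hn lam x hx l (by omega), mul_zero]

theorem le_sigmaI (n : ℕ) (x : ℕ → ℤ) (i q : ℕ) (hq : q ≤ n) :
    sig n x (q * n + i) ≤ sigmaI n x i := by
  unfold sigmaI
  have := Finset.le_sup' (fun j => sig n x ((j - 1) * n + i))
    (show q + 1 ∈ Finset.Icc 1 (n + 1) by rw [Finset.mem_Icc]; omega)
  simp only [Nat.add_sub_cancel] at this
  exact this

theorem exists_M (n : ℕ) (x : ℕ → ℤ) (i : ℕ) (hi1 : 1 ≤ i) (hin : i ≤ n) :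
    ∃ q, q ≤ n ∧ q * n + i ∈ Mset n x i := by
  obtain ⟨j, hj, h⟩ := Finset.exists_mem_eq_sup' (s := Finset.Icc 1 (n + 1))
    (Finset.nonempty_Icc.mpr (by omega)) (fun j => sig n x ((j - 1) * n + i))
  rw [Finset.mem_Icc] at hj
  exact ⟨j - 1, by omega, by omega, col_block n _ i hi1 hin, h.symm⟩

theorem Xc_add (n : ℕ) (x : ℕ → ℤ) (i q : ℕ) (c : ℤ) (hi1 : 1 ≤ i) (hin : i ≤ n) (a p : ℕ) :
    Xc n (fun l => x l + c * eVec (q * n + i) l) a (p + 1) =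
      Xc n x a (p + 1) + if a = i ∧ p = q then c else 0 := by
  simp only [Xc_succ, eVec]
  by_cases ha : 1 ≤ a ∧ a ≤ n
  · rw [if_pos ha, if_pos ha]
    by_cases h : a = i ∧ p = q
    · rw [if_pos h, h.1, h.2]; simp
    · rw [if_neg h, if_neg]
      · simp
      · intro he
        have := pos_inj n p q a i ha.1 ha.2 hi1 hin he
        exact h ⟨this.2, this.1⟩
  · rw [if_neg ha, if_neg ha, if_neg]
    · rfl
    · rintro ⟨rfl, -⟩; exact ha ⟨hi1, hin⟩

theorem nice_add (n : ℕ) (lam : ℕ → ℤ) (X Y : ℕ → ℕ → ℤ) (h : Nice n lam X) (i q : ℕ)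
    (hY : ∀ a p, Y a (p + 1) = X a (p + 1) + if a = i ∧ p = q then 1 else 0)
    (hz : i + q ≤ n)
    (h1 : ∀ p, q = p + 1 → X i (q + 1) < X (i + 1) q)
    (h2 : ∀ a, i = a + 1 → X i (q + 1) - X a (q + 1) < lam (i + q) - lam (i + q + 1)) :
    Nice n lam Y := by
  obtain ⟨c, l, z⟩ := h
  refine ⟨?_, ?_, ?_⟩
  · intro a p
    rw [hY a (p + 1), hY (a + 1) p]
    have : X a (p + 1 + 1) ≤ X (a + 1) (p + 1) := c a p
    by_cases h : a = i ∧ p + 1 = q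
    · obtain ⟨rfl, rfl⟩ := h
      have := h1 p rfl
      rw [if_pos ⟨rfl, rfl⟩]
      split_ifs <;> omega
    · rw [if_neg h]
      split_ifs <;> omega
  · intro a p hap
    rw [hY, hY]
    have := l a p hap
    by_cases h : a + 1 = i ∧ p = q
    · obtain ⟨rfl, rfl⟩ := h
      have := h2 a rfl
      rw [show a + 1 + p = a + p + 1 by ring, show a + p + 1 + 1 = a + p + 2 by ring] at this
      split_ifs <;> omega
    · rw [if_neg h]
      split_ifs <;> omega
  · intro a p hap
    rw [hY, z a p hap, if_neg (by omega)]; rfl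

theorem nice_sub (n : ℕ) (lam : ℕ → ℤ) (X Y : ℕ → ℕ → ℤ) (h : Nice n lam X) (i q : ℕ)
    (hY : ∀ a p, Y a (p + 1) = X a (p + 1) + if a = i ∧ p = q then -1 else 0)
    (hz : i + q ≤ n)
    (h1 : ∀ a, i = a + 1 → X a (q + 2) < X i (q + 1))
    (h2 : i + q < n → X (i + 1) (q + 1) - X i (q + 1) < lam (i + q + 1) - lam (i + q + 2)) :
    Nice n lam Y := by
  obtain ⟨c, l, z⟩ := h
  refine ⟨?_, ?_, ?_⟩
  · intro a p
    rw [hY a (p + 1), hY (a + 1) p]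
    have : X a (p + 1 + 1) ≤ X (a + 1) (p + 1) := c a p
    by_cases h : a + 1 = i ∧ p = q
    · obtain ⟨rfl, rfl⟩ := h
      have : X a (p + 1 + 1) < X (a + 1) (p + 1) := h1 a rfl
      split_ifs <;> omega
    · rw [if_neg h]
      split_ifs <;> omega
  · intro a p hap
    rw [hY, hY]
    have := l a p hap
    by_cases h : a = i ∧ p = q
    · obtain ⟨rfl, rfl⟩ := h
      have := h2 hap
      split_ifs <;> omega
    · rw [if_neg h]
      split_ifs <;> omega
  · intro a p hap
    rw [hY, z a p hap, if_neg (by omega)]; rfl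

/-- for `x ∈ Σ_ι[λ]` and `1 ≤ i ≤ n`:
(a) if `σ^{(i)}(x) > σ_0^{(i)}(x)` then `x + e_{min M^{(i)}(x)} ∈ Σ_ι[λ]`;
(b) if `σ^{(i)}(x) > 0` then `x - e_{max M^{(i)}(x)} ∈ Σ_ι[λ]`. -/
theorem stmt13 (n : ℕ) (hn : 1 ≤ n) (lam : ℕ → ℤ) (hlam : IsShape n lam)
    (x : ℕ → ℤ) (hx : InSigmaL n lam x) (i : ℕ) (hi1 : 1 ≤ i) (hin : i ≤ n) :
    (sigma0 n lam x i < sigmaI n x i →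
      InSigmaL n lam (fun l => x l + eVec (sInf (Mset n x i)) l)) ∧
    (0 < sigmaI n x i →
      InSigmaL n lam (fun l => x l - eVec (sSup (Mset n x i)) l)) := by
  have hN := nice_of n lam x hx
  obtain ⟨hc, hl, hz⟩ := id hN
  obtain ⟨q0, hq0, hM0⟩ := exists_M n x i hi1 hin
  have hX0 : ∀ p, Xc n x 0 p = 0 := fun p => by unfold Xc; simp
  obtain ⟨a, rfl⟩ : ∃ a, i = a + 1 := ⟨i - 1, by omega⟩
  constructor
  · intro hs
    have hmem : sInf (Mset n x (a + 1)) ∈ Mset n x (a + 1) := Nat.sInf_mem ⟨_, hM0⟩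
    have hmin : sInf (Mset n x (a + 1)) ≤ q0 * n + (a + 1) := Nat.sInf_le hM0
    have hnot : ∀ m, m < sInf (Mset n x (a + 1)) → m ∉ Mset n x (a + 1) :=
      fun m hm => Nat.notMem_of_lt_sInf hm
    generalize sInf (Mset n x (a + 1)) = k at *
    obtain ⟨hk1, hkc, hks⟩ := hmem
    obtain ⟨q, hq⟩ := pos_decomp n k hn hk1
    rw [hkc] at hq
    subst hq
    have hqq : q ≤ q0 := by
      have : q * n ≤ q0 * n := by omega
      exact Nat.le_of_mul_le_mul_right this (by omega)
    have hXa := Xc_add n x (a + 1) q 1 hi1 hin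
    simp only [one_mul] at hXa
    apply of_nice
    · simp [eVec, hx.1.1]
    · rcases q with _ | p
      · rw [sigma0_eq_s13 n lam x (a + 1) hi1 hin, ← hks] at hs
        simp only [Nat.zero_mul, Nat.zero_add, Nat.add_sub_cancel] at hs
        refine nice_add n lam _ _ hN (a + 1) 0 hXa (by omega) (by intro p hp; omega) ?_
        intro b hb
        obtain rfl : a = b := by omega
        simp only [Nat.zero_add, Nat.add_zero]
        omega
      · have hd := sig_diff n x (a + 1) p hi1 hin (by omega)
        have hle := le_sigmaI n x (a + 1) p (by omega)
        have hne : sig n x (p * n + (a + 1)) ≠ sigmaI n x (a + 1) := by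
          intro he
          refine hnot (p * n + (a + 1)) ?_ ⟨by omega, col_block n p _ hi1 hin, he⟩
          rw [show (p + 1) * n = p * n + n by ring]; omega
        simp only [Nat.add_sub_cancel] at hd
        have c1 := hc a p
        have hzz : a + 1 + (p + 1) ≤ n := by
          by_contra hcon
          have := hz (a + 1) (p + 1) (by omega)
          have := hz (a + 1 + 1) p (by omega)
          simp only [Nat.add_assoc, Nat.reduceAdd] at *
          omega
        refine nice_add n lam _ _ hN (a + 1) (p + 1) hXa hzz ?_ ?_
        · intro p' hp'
          simp only [Nat.add_assoc, Nat.reduceAdd] at *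
          omega
        · intro b hb
          obtain rfl : a = b := by omega
          have l1 := hl (a + 1) p (by omega)
          rw [show a + 1 + (p + 1) = a + 1 + p + 1 by ring]
          simp only [Nat.add_assoc, Nat.reduceAdd] at *
          omega
  · intro hs
    have hbd : BddAbove (Mset n x (a + 1)) := by
      refine ⟨n * n, fun m hm => ?_⟩
      by_contra hcon
      have := sig_zero n hn lam x hx m (by omega)
      have := hm.2.2
      omega
    have hmem : sSup (Mset n x (a + 1)) ∈ Mset n x (a + 1) := Nat.sSup_mem ⟨_, hM0⟩ hbd
    have hnot : ∀ m, sSup (Mset n x (a + 1)) < m → m ∉ Mset n x (a + 1) :=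
      fun m hm hm' => absurd (le_csSup hbd hm') (by omega)
    generalize sSup (Mset n x (a + 1)) = k at *
    obtain ⟨hk1, hkc, hks⟩ := hmem
    obtain ⟨q, hq⟩ := pos_decomp n k hn hk1
    rw [hkc] at hq
    subst hq
    have hqn : q < n := by
      by_contra hcon
      have : n * n ≤ q * n := Nat.mul_le_mul_right n (by omega)
      have := sig_zero n hn lam x hx (q * n + (a + 1)) (by omega)
      omega
    have hXa := Xc_add n x (a + 1) q (-1) hi1 hin
    simp only [neg_mul, one_mul, ← sub_eq_add_neg] at hXa
    have hd := sig_diff n x (a + 1) q hi1 hin hqn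
    have hle := le_sigmaI n x (a + 1) (q + 1) (by omega)
    have hne : sig n x ((q + 1) * n + (a + 1)) ≠ sigmaI n x (a + 1) := by
      intro he
      refine hnot ((q + 1) * n + (a + 1)) ?_ ⟨by omega, col_block n _ _ hi1 hin, he⟩
      rw [show (q + 1) * n = q * n + n by ring]; omega
    simp only [Nat.add_sub_cancel] at hd
    have hzz : a + 1 + q ≤ n := by
      by_contra hcon
      have := hz (a + 1) q (by omega)
      have := hz (a + 1) (q + 1) (by omega)
      have := hz (a + 1 + 1) q (by omega)
      have := hz a (q + 1) (by omega)
      simp only [Nat.add_assoc, Nat.reduceAdd] at *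
      omega
    apply of_nice
    · simp [eVec, hx.1.1]
    · refine nice_sub n lam _ _ hN (a + 1) q hXa hzz ?_ ?_
      · intro b hb
        obtain rfl : a = b := by omega
        have c1 := hc (a + 1) q
        omega
      · intro hlt
        have l1 := hl a (q + 1) (by omega)
        rw [show a + (q + 1) + 1 = a + 1 + q + 1 by ring,
          show a + (q + 1) + 2 = a + 1 + q + 2 by ring] at l1
        simp only [Nat.add_assoc, Nat.reduceAdd] at *
        omega


end PolyReal
end

section
/- Let g ∈ GT_λ and define the family Z_g by z(m,k) := y_{n+2−m−k}^{(k)} − y_{n+3−m−k}^{(k−1)} for 1 ≤ m ≤ n and 1 ≤ k ≤ n+1−m, where y_l^{(0)} := λ_l. Then Z_g is a z-array (i.e. all its entries are nonnegative), and ψ_∞(Z_g) = ς_λ(g); equivalently, Σ_{k=1}^{i} z(n+2−i−j, k) = y_j^{(i)} − λ_{i+j} for all 1 ≤ i ≤ n and 1 ≤ j ≤ n+1−i. -/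
namespace PolyReal

/-- for `g ∈ GT_λ`, the family `Z_g` is a z-array and
`ψ_∞(Z_g) = ς_λ(g)`; equivalently
`Σ_{k=1}^{i} z(n+2-i-j, k) = y_j^{(i)} - λ_{i+j}` for all `1 ≤ i ≤ n`,
`1 ≤ j ≤ n+1-i`. -/
theorem stmt15 (n : ℕ) (hn : 1 ≤ n) (lam : ℕ → ℤ) (hlam : IsShape n lam)
    (g : ℕ → ℕ → ℤ) (hg : IsGT n lam g) :
    IsZArray n (Zg n g) ∧
    psiInf n (Zg n g) = varsig n lam g ∧
    (∀ i j, 1 ≤ i → i ≤ n → 1 ≤ j → j ≤ n + 1 - i →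
      ∑ k ∈ Finset.Icc 1 i, Zg n g (n + 2 - i - j) k = g i j - lam (i + j)) := by
  have key : ∀ m, 1 ≤ m → m ≤ n → ∀ i, i ≤ n + 1 - m →
      ∑ k ∈ Finset.Icc 1 i, Zg n g m k = g i (n + 2 - m - i) - g 0 (n + 2 - m) := by
    intro m hm1 hm2 i
    induction i with
    | zero => intro _; simp
    | succ i ih =>
      intro hi
      rw [Finset.sum_Icc_succ_top (by omega), ih (by omega)]
      unfold Zg
      rw [if_pos (by omega)]
      have e : n + 3 - m - (i + 1) = n + 2 - m - i := by omega
      rw [e, Nat.add_sub_cancel]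
      ring
  obtain ⟨-, h0, hint, -⟩ := hg
  have main : ∀ i j, 1 ≤ i → i ≤ n → 1 ≤ j → j ≤ n + 1 - i →
      ∑ k ∈ Finset.Icc 1 i, Zg n g (n + 2 - i - j) k = g i j - lam (i + j) := by
    intro i j hi hin hj hji
    rw [key _ (by omega) (by omega) i (by omega)]
    have e1 : n + 2 - (n + 2 - i - j) - i = j := by omega
    have e2 : n + 2 - (n + 2 - i - j) = i + j := by omega
    rw [e1, e2, h0 _ (by omega) (by omega)]
  refine ⟨⟨?_, ?_⟩, ?_, main⟩
  · intro m k h1 h2 h3 h4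
    unfold Zg
    rw [if_pos ⟨h1, h2, h3, h4⟩]
    have h := (hint k (n + 2 - m - k) h3 (by omega) (by omega) (by omega)).2
    have e : n + 2 - m - k + 1 = n + 3 - m - k := by omega
    rw [e] at h
    linarith
  · intro m k h
    unfold Zg
    rw [if_neg h]
  · funext p
    unfold psiInf varsig
    split_ifs with hp hq
    · rfl
    · generalize (p - 1) % n = a at *
      generalize (p - 1) / n = b at *
      exact main _ _ (by omega) (by omega) (by omega) (by omega)
    · rfl

end PolyReal
end

section
/- The map g ↦ Z_g from GT_λ to z-arrays is injective, and a z-array Z lies in its image if and only if Σ_{k=1}^{i−j+1} z(n+1−i, k) − Σ_{k=1}^{i−j} z(n+2−i, k) ≤ λ_i − λ_{i+1} for all 1 ≤ j ≤ i ≤ n (empty sums being 0). -/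
namespace PolyReal

theorem gt_formula (n : ℕ) (lam : ℕ → ℤ) (g : ℕ → ℕ → ℤ) (hg : IsGT n lam g) (i : ℕ) :
    ∀ j, 1 ≤ j → i + j ≤ n + 1 →
      g i j = lam (i + j) + ∑ k ∈ Finset.Icc 1 i, Zg n g (n + 2 - i - j) k := by
  induction i with
  | zero =>
    intro j h1 h2
    simp only [zero_add]
    rw [hg.2.1 j h1 (by omega)]
    simp
  | succ i ih =>
    intro j h1 h2
    have h := ih (j + 1) (by omega) (by omega)
    rw [Finset.sum_Icc_succ_top (by omega)]
    have e1 : n + 2 - i - (j + 1) = n + 2 - (i + 1) - j := by omega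
    have e2 : i + (j + 1) = i + 1 + j := by omega
    rw [e1, e2] at h
    have hz : Zg n g (n + 2 - (i + 1) - j) (i + 1) = g (i + 1) j - g i (j + 1) := by
      unfold Zg
      rw [if_pos (by omega)]
      congr 2 <;> omega
    rw [hz]
    linarith

theorem lam_nonneg (n : ℕ) (lam : ℕ → ℤ) (hlam : IsShape n lam) (d : ℕ) :
    ∀ k, 1 ≤ k → k + d = n + 1 → 0 ≤ lam k := by
  induction d with
  | zero =>
    intro k _ h
    have : k = n + 1 := by omega
    rw [this, hlam.2]
  | succ d ih =>
    intro k h1 h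
    exact (ih (k + 1) (by omega) (by omega)).trans (hlam.1 k h1 (by omega))

/-- the map `g ↦ Z_g` from `GT_λ` to z-arrays is injective, and a
z-array `Z` lies in its image iff
`Σ_{k=1}^{i-j+1} z(n+1-i, k) - Σ_{k=1}^{i-j} z(n+2-i, k) ≤ λ_i - λ_{i+1}`
for all `1 ≤ j ≤ i ≤ n`. -/
theorem stmt16 (n : ℕ) (hn : 1 ≤ n) (lam : ℕ → ℤ) (hlam : IsShape n lam) :
    (∀ g g' : ℕ → ℕ → ℤ, IsGT n lam g → IsGT n lam g' → Zg n g = Zg n g' → g = g') ∧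
    (∀ Z : ℕ → ℕ → ℤ, IsZArray n Z →
      ((∃ g, IsGT n lam g ∧ Zg n g = Z) ↔
        (∀ i j, 1 ≤ j → j ≤ i → i ≤ n →
          ∑ k ∈ Finset.Icc 1 (i - j + 1), Z (n + 1 - i) k
            - ∑ k ∈ Finset.Icc 1 (i - j), Z (n + 2 - i) k ≤ lam i - lam (i + 1)))) := by
  refine ⟨?_, ?_⟩
  · intro g g' hg hg' h
    funext i k
    by_cases hr : i ≤ n ∧ 1 ≤ k ∧ k ≤ n + 1 - i
    · rw [gt_formula n lam g hg i k hr.2.1 (by omega),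
        gt_formula n lam g' hg' i k hr.2.1 (by omega), h]
    · rw [hg.2.2.2 i k hr, hg'.2.2.2 i k hr]
  · intro Z hZ
    constructor
    · rintro ⟨g, hg, rfl⟩ i j h1 h2 h3
      have a := gt_formula n lam g hg (i - j + 1) j h1 (by omega)
      have b := gt_formula n lam g hg (i - j) j h1 (by omega)
      have c := (hg.2.2.1 (i - j + 1) j (by omega) (by omega) h1 (by omega)).1
      rw [Nat.add_sub_cancel] at c
      rw [show n + 2 - (i - j + 1) - j = n + 1 - i by omega,
        show i - j + 1 + j = i + 1 by omega] at a
      rw [show n + 2 - (i - j) - j = n + 2 - i by omega,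
        show i - j + j = i by omega] at b
      linarith
    · intro H
      have key : ∀ i j, i ≤ n ∧ 1 ≤ j ∧ j ≤ n + 1 - i →
          (fun i j : ℕ => if i ≤ n ∧ 1 ≤ j ∧ j ≤ n + 1 - i then
            lam (i + j) + ∑ k ∈ Finset.Icc 1 i, Z (n + 2 - i - j) k else 0) i j =
          lam (i + j) + ∑ k ∈ Finset.Icc 1 i, Z (n + 2 - i - j) k := by
        intro i j h
        exact if_pos h
      have key0 : ∀ i j, ¬ (i ≤ n ∧ 1 ≤ j ∧ j ≤ n + 1 - i) →
          (fun i j : ℕ => if i ≤ n ∧ 1 ≤ j ∧ j ≤ n + 1 - i then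
            lam (i + j) + ∑ k ∈ Finset.Icc 1 i, Z (n + 2 - i - j) k else 0) i j = 0 := by
        intro i j h
        exact if_neg h
      generalize hG : (fun i j : ℕ => if i ≤ n ∧ 1 ≤ j ∧ j ≤ n + 1 - i then
            lam (i + j) + ∑ k ∈ Finset.Icc 1 i, Z (n + 2 - i - j) k else 0) = G at key key0
      have step : ∀ i j, i + 1 ≤ n → 1 ≤ j → j ≤ n + 1 - (i + 1) →
          G (i + 1) j = G i (j + 1) + Z (n + 2 - (i + 1) - j) (i + 1) := by
        intro i j h1 h2 h3
        rw [key (i + 1) j (by omega), key i (j + 1) (by omega),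
          Finset.sum_Icc_succ_top (by omega),
          show n + 2 - i - (j + 1) = n + 2 - (i + 1) - j by omega,
          show i + (j + 1) = i + 1 + j by omega]
        ring
      refine ⟨G, ⟨?_, ?_, ?_, key0⟩, ?_⟩
      · intro i k h1 h2 h3
        rw [key i k ⟨h1, h2, h3⟩]
        refine add_nonneg (lam_nonneg n lam hlam (n + 1 - (i + k)) _ (by omega) (by omega)) ?_
        refine Finset.sum_nonneg fun l hl => ?_
        rw [Finset.mem_Icc] at hl
        exact hZ.1 _ _ (by omega) (by omega) (by omega) (by omega)
      · intro k h1 h2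
        rw [key 0 k (by omega)]
        simp
      · intro i k h1 h2 h3 h4
        obtain ⟨i, rfl⟩ : ∃ i', i = i' + 1 := ⟨i - 1, by omega⟩
        rw [Nat.add_sub_cancel]
        constructor
        · have := H (i + k) k h3 (by omega) (by omega)
          rw [key (i + 1) k (by omega), key i k (by omega)]
          rw [Nat.add_sub_cancel] at this
          rw [show n + 2 - (i + 1) - k = n + 1 - (i + k) by omega,
            show n + 2 - i - k = n + 2 - (i + k) by omega,
            show i + 1 + k = i + k + 1 by omega]
          linarith
        · rw [step i k h2 h3 h4]
          have := hZ.1 (n + 2 - (i + 1) - k) (i + 1) (by omega) (by omega) (by omega) (by omega)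
          linarith
      · funext m k
        unfold Zg
        split_ifs with h
        · obtain ⟨k, rfl⟩ : ∃ k', k = k' + 1 := ⟨k - 1, by omega⟩
          rw [step k (n + 2 - m - (k + 1)) (by omega) (by omega) (by omega),
            Nat.add_sub_cancel,
            show n + 2 - m - (k + 1) + 1 = n + 3 - m - (k + 1) by omega,
            show n + 2 - (k + 1) - (n + 2 - m - (k + 1)) = m by omega]
          ring
        · exact (hZ.2 m k h).symm

end PolyReal
end
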